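/- Let f : Bᵏ → B be a non-linear term function of B and let Aut(f) denote the group of all bijections of B preserving f. Then exactly one of the following holds: Aut(f) is the group of Boolean automorphisms of B, or Aut(f) = Aut(M), the group of all bijections preserving the median M(x, y, z) = x·y + y·z + z·x. -/

import Mathlib

open scoped symmDiff

/-- `B` is atomless: below every nonzero element there is a strictly smaller nonzero element. -/
def Atomless (B : Type*) [Preorder B] [OrderBot B] : Prop :=
  ∀ a : B, ⊥ < a → ∃ b : B, ⊥ < b ∧ b < a

/-- A Boolean automorphism: a bijection preserving meet, join and complement. -/
def IsBoolAut {B : Type*} [BooleanAlgebra B] (φ : B → B) : Prop :=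
  Function.Bijective φ ∧ (∀ x y, φ (x ⊓ y) = φ x ⊓ φ y) ∧
    (∀ x y, φ (x ⊔ y) = φ x ⊔ φ y) ∧ (∀ x, φ xᶜ = (φ x)ᶜ)

/-- The term function of arity `k` determined by a set `S` of monomials: the iterated
symmetric difference, over `ε ∈ S`, of the meets `Π_{i ∈ ε} x i` (empty meet is `⊤ = 1`,
empty sum is `⊥ = 0`). -/
def termFun {B : Type*} [BooleanAlgebra B] {k : ℕ} (S : Finset (Finset (Fin k)))
    (x : Fin k → B) : B :=
  S.fold (· ∆ ·) ⊥ fun ε => ε.inf x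

/-- `f` is a non-linear term function: it is given by a set `S` of monomials, one of which
has degree at least `2`. -/
def IsNonLinearTermFun {B : Type*} [BooleanAlgebra B] {k : ℕ} (f : (Fin k → B) → B) : Prop :=
  ∃ S : Finset (Finset (Fin k)), (∀ x, f x = termFun S x) ∧ ∃ ε ∈ S, 2 ≤ ε.card

/-- A bijection `φ` preserves a `k`-ary function `f` if `φ (f x₁ … x_k) = f (φ x₁) … (φ x_k)`. -/
def Preserves {B : Type*} {k : ℕ} (φ : B → B) (f : (Fin k → B) → B) : Prop :=
  ∀ x : Fin k → B, φ (f x) = f fun i => φ (x i)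

/-- The median function `M(x,y,z) = x·y + y·z + z·x` on a Boolean algebra,
written with symmetric difference as `+` and meet as `·`. -/
def median {B : Type*} [BooleanAlgebra B] (x y z : B) : B :=
  (x ⊓ y) ∆ ((y ⊓ z) ∆ (z ⊓ x))

/-- The ring form of `termFun`: a sum of monomials in a Boolean ring. -/
def monomialSum {R ι : Type*} [BooleanRing R] (S : Finset (Finset ι)) (x : ι → R) : R :=
  ∑ ε ∈ S, ∏ i ∈ ε, x i

section BooleanRing

variable {R : Type*} [BooleanRing R]

lemma BooleanRing.two_eq_zero : (2 : R) = 0 := by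
  rw [← one_add_one_eq_two, BooleanRing.add_self]

/-- The set `{0, 1}` is closed under addition in a Boolean ring. -/
lemma zero_or_one_add {a b : R} (ha : a = 0 ∨ a = 1) (hb : b = 0 ∨ b = 1) :
    a + b = 0 ∨ a + b = 1 := by
  rcases ha with rfl | rfl <;> rcases hb with rfl | rfl <;> simp [BooleanRing.add_self]

open BooleanRing in
/-- A map preserving a binary polynomial of degree two preserves the product or the join. -/
lemma preserves_mul_or_join_of_binary {φ : R → R} {a b d : R}
    (ha : a = 0 ∨ a = 1) (hb : b = 0 ∨ b = 1) (hd : d = 0 ∨ d = 1)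
    (h : ∀ x y, φ (x * y + a * x + b * y + d) = φ x * φ y + a * φ x + b * φ y + d) :
    (∀ x y, φ (x * y) = φ x * φ y) ∨
      ∀ x y, φ (x * y + x + y) = φ x * φ y + φ x + φ y := by
  have htwo : (2 : R) = 0 := two_eq_zero
  rcases hd with rfl | rfl <;> rcases ha with rfl | rfl <;> rcases hb with rfl | rfl <;>
    simp only [zero_mul, one_mul, add_zero] at h
  · exact .inl h
  · refine .inl fun x y => ?_
    have h1 := h (x * y + y) y
    rw [h x y] at h1
    refine (congrArg φ ?_).trans (h1.trans ?_) <;> clear h h1 <;>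
      grind [mul_self x, mul_self y, mul_self (φ x), mul_self (φ y)]
  · refine .inl fun x y => ?_
    have h1 := h x (x * y + x)
    rw [h x y] at h1
    refine (congrArg φ ?_).trans (h1.trans ?_) <;> clear h h1 <;>
      grind [mul_self x, mul_self y, mul_self (φ x), mul_self (φ y)]
  · exact .inr h
  · refine .inl fun x y => ?_
    have h1 := h (x * y + 1) (x * y + 1)
    rw [h x y] at h1
    refine (congrArg φ ?_).trans (h1.trans ?_) <;> clear h h1 <;>
      grind [mul_self x, mul_self y, mul_self (φ x), mul_self (φ y)]
  · refine .inr fun x y => ?_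
    have h1 := h x (x * y + y + 1)
    rw [h x y] at h1
    refine (congrArg φ ?_).trans (h1.trans ?_) <;> clear h h1 <;>
      grind [mul_self x, mul_self y, mul_self (φ x), mul_self (φ y)]
  · refine .inr fun x y => ?_
    have h1 := h (x * y + x + 1) y
    rw [h x y] at h1
    refine (congrArg φ ?_).trans (h1.trans ?_) <;> clear h h1 <;>
      grind [mul_self x, mul_self y, mul_self (φ x), mul_self (φ y)]
  · refine .inr fun x y => ?_
    have h1 := h (x * y + x + y + 1) (x * y + x + y + 1)
    rw [h x y] at h1
    refine (congrArg φ ?_).trans (h1.trans ?_) <;> clear h h1 <;>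
      grind [mul_self x, mul_self y, mul_self (φ x), mul_self (φ y)]

open BooleanRing in
/-- A map preserving the median plus a linear form preserves the product, the join or the
median. -/
lemma preserves_mul_or_join_or_median_of_median_add {φ : R → R} {a b c d : R}
    (ha : a = 0 ∨ a = 1) (hb : b = 0 ∨ b = 1) (hc : c = 0 ∨ c = 1) (hd : d = 0 ∨ d = 1)
    (h : ∀ x y z, φ (x * y + y * z + z * x + a * x + b * y + c * z + d) =
      φ x * φ y + φ y * φ z + φ z * φ x + a * φ x + b * φ y + c * φ z + d) :
    (∀ x y, φ (x * y) = φ x * φ y) ∨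
      (∀ x y, φ (x * y + x + y) = φ x * φ y + φ x + φ y) ∨
      ∀ x y z, φ (x * y + y * z + z * x) = φ x * φ y + φ y * φ z + φ z * φ x := by
  have htwo : (2 : R) = 0 := two_eq_zero
  have hdiag : ∀ x, φ ((1 + a + b + c) * x + d) = (1 + a + b + c) * φ x + d := by
    intro x
    have h1 := h x x x
    refine (congrArg φ ?_).trans (h1.trans ?_) <;> clear h h1 <;>
      grind [mul_self x, mul_self (φ x)]
  rcases zero_or_one_add (zero_or_one_add ha hb) hc with hs | hs
  · have key : ∀ x y z, φ (x * y + y * z + z * x + a * x + b * y + c * z) =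
        φ x * φ y + φ y * φ z + φ z * φ x + a * φ x + b * φ y + c * φ z := by
      rcases hd with rfl | rfl
      · simpa only [add_zero] using h
      · intro x y z
        have hneg : ∀ x, φ (x + 1) = φ x + 1 := by
          intro x
          have h1 := hdiag x
          refine (congrArg φ ?_).trans (h1.trans ?_) <;> clear h hdiag h1 <;> grind
        have h1 := h x y z
        rw [hneg] at h1
        exact add_right_cancel h1
    refine .inr (.inr fun x y z => ?_)
    cases subsingleton_or_nontrivial R
    · exact Subsingleton.elim _ _
    rcases ha with rfl | rfl <;> rcases hb with rfl | rfl <;> rcases hc with rfl | rfl <;>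
      simp only [zero_mul, one_mul, add_zero, zero_add, add_self] at hs key
    · exact key x y z
    · exact absurd hs one_ne_zero
    · exact absurd hs one_ne_zero
    · have h1 := key (x * y + y * z + z * x + y + z) y z
      rw [key x y z] at h1
      refine (congrArg φ ?_).trans (h1.trans ?_) <;> clear h hdiag key h1 <;>
        grind [mul_self x, mul_self y, mul_self z, mul_self (φ x), mul_self (φ y), mul_self (φ z)]
    · exact absurd hs one_ne_zero
    · have h1 := key x (x * y + y * z + z * x + x + z) z
      rw [key x y z] at h1
      refine (congrArg φ ?_).trans (h1.trans ?_) <;> clear h hdiag key h1 <;>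
        grind [mul_self x, mul_self y, mul_self z, mul_self (φ x), mul_self (φ y), mul_self (φ z)]
    · have h1 := key x y (x * y + y * z + z * x + x + y)
      rw [key x y z] at h1
      refine (congrArg φ ?_).trans (h1.trans ?_) <;> clear h hdiag key h1 <;>
        grind [mul_self x, mul_self y, mul_self z, mul_self (φ x), mul_self (φ y), mul_self (φ z)]
    · exact absurd hs one_ne_zero
  · have hφd : φ d = d := by
      have h1 := hdiag 0
      refine (congrArg φ ?_).trans (h1.trans ?_) <;> clear h hdiag h1 <;> grind
    rw [← or_assoc]
    refine .inl (preserves_mul_or_join_of_binary (a := a + d) (b := b + d) (d := c * d + d)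
      (zero_or_one_add ha hd) (zero_or_one_add hb hd) ?_ fun x y => ?_)
    · rcases hc with rfl | rfl <;> rcases hd with rfl | rfl <;> simp [add_self]
    · have h1 := h x y d
      rw [hφd] at h1
      refine (congrArg φ ?_).trans (h1.trans ?_) <;> ring

open BooleanRing in
/-- A map preserving a ternary polynomial in which `x * y` has coefficient one preserves the
product, the join or the median. -/
lemma preserves_mul_or_join_or_median_of_ternary {φ : R → R} {p q r a b c d : R}
    (hp : p = 0 ∨ p = 1) (hq : q = 0 ∨ q = 1) (hr : r = 0 ∨ r = 1)
    (ha : a = 0 ∨ a = 1) (hb : b = 0 ∨ b = 1) (hc : c = 0 ∨ c = 1) (hd : d = 0 ∨ d = 1)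
    (h : ∀ x y z, φ (p * (x * y * z) + x * y + q * (y * z) + r * (z * x) +
        a * x + b * y + c * z + d) =
      p * (φ x * φ y * φ z) + φ x * φ y + q * (φ y * φ z) + r * (φ z * φ x) +
        a * φ x + b * φ y + c * φ z + d) :
    (∀ x y, φ (x * y) = φ x * φ y) ∨
      (∀ x y, φ (x * y + x + y) = φ x * φ y + φ x + φ y) ∨
      ∀ x y z, φ (x * y + y * z + z * x) = φ x * φ y + φ y * φ z + φ z * φ x := by
  have htwo : (2 : R) = 0 := two_eq_zero
  rcases zero_or_one_add hp hq with h1 | h1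
  · rw [← or_assoc]
    refine .inl (preserves_mul_or_join_of_binary (a := r + a + c) (b := b) (d := d)
      (zero_or_one_add (zero_or_one_add hr ha) hc) hb hd fun x y => ?_)
    have h2 := h x y x
    refine (congrArg φ ?_).trans (h2.trans ?_) <;> clear h h2 <;>
      grind [mul_self x, mul_self y, mul_self (φ x), mul_self (φ y)]
  rcases zero_or_one_add hp hr with h1' | h1'
  · rw [← or_assoc]
    refine .inl (preserves_mul_or_join_of_binary (a := a) (b := q + b + c) (d := d)
      ha (zero_or_one_add (zero_or_one_add hq hb) hc) hd fun x y => ?_)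
    have h2 := h x y y
    refine (congrArg φ ?_).trans (h2.trans ?_) <;> clear h h2 <;>
      grind [mul_self x, mul_self y, mul_self (φ x), mul_self (φ y)]
  rcases hp with rfl | rfl
  · obtain rfl : q = 1 := by simpa using h1
    obtain rfl : r = 1 := by simpa using h1'
    exact preserves_mul_or_join_or_median_of_median_add ha hb hc hd
      (by simpa only [zero_mul, one_mul, zero_add] using h)
  · obtain rfl : q = 0 := by simpa using h1
    obtain rfl : r = 0 := by simpa using h1'
    rw [← or_assoc]
    refine .inl (preserves_mul_or_join_of_binary (a := c) (b := a + b + 1) (d := d)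
      hc (zero_or_one_add (zero_or_one_add ha hb) (.inr rfl)) hd fun x y => ?_)
    have h2 := h y y x
    refine (congrArg φ ?_).trans (h2.trans ?_) <;> clear h h2 <;>
      grind [mul_self x, mul_self y, mul_self (φ x), mul_self (φ y)]

/-- Merging the variables of a sum of monomials into three classes gives a ternary polynomial
with coefficients in `{0, 1}`. -/
lemma exists_coeff_monomialSum_comp {ι : Type*} (S : Finset (Finset ι)) (τ : ι → Fin 3) :
    ∃ p s q r a b c d : R, (p = 0 ∨ p = 1) ∧ (s = 0 ∨ s = 1) ∧ (q = 0 ∨ q = 1) ∧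
      (r = 0 ∨ r = 1) ∧ (a = 0 ∨ a = 1) ∧ (b = 0 ∨ b = 1) ∧ (c = 0 ∨ c = 1) ∧
      (d = 0 ∨ d = 1) ∧ ∀ x y z : R, monomialSum S (fun i => ![x, y, z] (τ i)) =
        p * (x * y * z) + s * (x * y) + q * (y * z) + r * (z * x) +
          a * x + b * y + c * z + d := by
  classical
  have hm : ∀ x : R, x * x = x := BooleanRing.mul_self
  have monomial : ∀ ε : Finset ι, ∃ u v w : Bool, ∀ x y z : R,
      ∏ i ∈ ε, ![x, y, z] (τ i) =
        (if u then x else 1) * (if v then y else 1) * (if w then z else 1) := by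
    intro ε
    induction ε using Finset.induction_on with
    | empty => exact ⟨false, false, false, by simp⟩
    | insert i ε hi ih =>
      obtain ⟨u, v, w, ih⟩ := ih
      simp only [Finset.prod_insert hi, ih]
      generalize τ i = t
      fin_cases t
      · refine ⟨true, v, w, fun x y z => ?_⟩
        cases u <;> simp [← mul_assoc, hm]
      · refine ⟨u, true, w, fun x y z => ?_⟩
        cases v <;> simp <;> clear ih hm <;> grind [BooleanRing.mul_self y]
      · refine ⟨u, v, true, fun x y z => ?_⟩
        cases w <;> simp <;> clear ih hm <;> grind [BooleanRing.mul_self z]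
  induction S using Finset.induction_on with
  | empty => exact ⟨0, 0, 0, 0, 0, 0, 0, 0, by simp [monomialSum]⟩
  | insert ε S hε ih =>
    obtain ⟨p, s, q, r, a, b, c, d, hp, hs, hq, hr, ha, hb, hc, hd, ih⟩ := ih
    obtain ⟨u, v, w, huvw⟩ := monomial ε
    simp only [monomialSum] at ih
    simp only [monomialSum, Finset.sum_insert hε, ih, huvw]
    have one : (1 : R) = 0 ∨ (1 : R) = 1 := .inr rfl
    rcases u <;> rcases v <;> rcases w <;> simp only [if_true, Bool.false_eq_true, if_false]
    · exact ⟨p, s, q, r, a, b, c, d + 1, hp, hs, hq, hr, ha, hb, hc, zero_or_one_add hd one,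
        fun x y z => by ring⟩
    · exact ⟨p, s, q, r, a, b, c + 1, d, hp, hs, hq, hr, ha, hb, zero_or_one_add hc one, hd,
        fun x y z => by ring⟩
    · exact ⟨p, s, q, r, a, b + 1, c, d, hp, hs, hq, hr, ha, zero_or_one_add hb one, hc, hd,
        fun x y z => by ring⟩
    · exact ⟨p, s, q + 1, r, a, b, c, d, hp, hs, zero_or_one_add hq one, hr, ha, hb, hc, hd,
        fun x y z => by ring⟩
    · exact ⟨p, s, q, r, a + 1, b, c, d, hp, hs, hq, hr, zero_or_one_add ha one, hb, hc, hd,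
        fun x y z => by ring⟩
    · exact ⟨p, s, q, r + 1, a, b, c, d, hp, hs, hq, zero_or_one_add hr one, ha, hb, hc, hd,
        fun x y z => by ring⟩
    · exact ⟨p, s + 1, q, r, a, b, c, d, hp, zero_or_one_add hs one, hq, hr, ha, hb, hc, hd,
        fun x y z => by ring⟩
    · exact ⟨p + 1, s, q, r, a, b, c, d, zero_or_one_add hp one, hs, hq, hr, ha, hb, hc, hd,
        fun x y z => by ring⟩

/-- A sum of monomials containing one of degree at least two has a merging of variables into
three classes under which `x * y` gets coefficient one. -/
lemma exists_merge_second_difference_eq_one {ι : Type*} {S : Finset (Finset ι)}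
    (hS : ∃ ε ∈ S, 2 ≤ ε.card) :
    ∃ τ : ι → Fin 3,
      monomialSum S (fun i => ![(1 : R), 1, 0] (τ i)) +
        monomialSum S (fun i => ![(1 : R), 0, 0] (τ i)) +
        monomialSum S (fun i => ![(0 : R), 1, 0] (τ i)) +
        monomialSum S (fun i => ![(0 : R), 0, 0] (τ i)) = 1 := by
  classical
  obtain ⟨ε, hεS, hε2, hmin⟩ : ∃ ε ∈ S, 2 ≤ ε.card ∧
      ∀ δ ∈ S, 2 ≤ δ.card → ε.card ≤ δ.card := by
    obtain ⟨ε, hε, hle⟩ := Finset.exists_min_image (S.filter (2 ≤ ·.card)) Finset.card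
      (by obtain ⟨ε, hε, h2⟩ := hS; exact ⟨ε, by simp [hε, h2]⟩)
    simp only [Finset.mem_filter] at hε hle
    exact ⟨ε, hε.1, hε.2, fun δ h1 h2 => hle δ ⟨h1, h2⟩⟩
  obtain ⟨j, hj, l, hl, hjl⟩ := Finset.one_lt_card.mp hε2
  refine ⟨fun i => if i = j then 0 else if i ∈ ε then 1 else 2, ?_⟩
  simp only [monomialSum, ← Finset.sum_add_distrib]
  rw [Finset.sum_eq_single_of_mem ε hεS]
  · have h11 : ∏ i ∈ ε, ![(1 : R), 1, 0] (if i = j then 0 else if i ∈ ε then 1 else 2) = 1 :=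
      Finset.prod_eq_one fun i hi => by by_cases h : i = j <;> simp [h, hi]
    have h10 : ∏ i ∈ ε, ![(1 : R), 0, 0] (if i = j then 0 else if i ∈ ε then 1 else 2) = 0 :=
      Finset.prod_eq_zero hl (by simp [hl, hjl.symm])
    have h01 : ∏ i ∈ ε, ![(0 : R), 1, 0] (if i = j then 0 else if i ∈ ε then 1 else 2) = 0 :=
      Finset.prod_eq_zero hj (by simp)
    have h00 : ∏ i ∈ ε, ![(0 : R), 0, 0] (if i = j then 0 else if i ∈ ε then 1 else 2) = 0 :=
      Finset.prod_eq_zero hj (by simp)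
    rw [h11, h10, h01, h00]
    simp
  · intro δ hδ hne
    by_cases hsub : δ ⊆ ε
    · have hcard : δ.card ≤ 1 := by
        by_contra! h
        exact hne (Finset.eq_of_subset_of_card_le hsub (hmin δ hδ h))
      rcases δ.eq_empty_or_nonempty with rfl | ⟨i, hi⟩
      · simp [BooleanRing.add_self]
      · obtain rfl : δ = {i} := Finset.eq_singleton_iff_unique_mem.mpr
          ⟨hi, fun i' hi' => Finset.card_le_one.mp hcard _ hi' _ hi⟩
        have hiε : i ∈ ε := hsub hi
        by_cases h : i = j <;> simp [h, hiε, BooleanRing.add_self]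
    · obtain ⟨i, hi, hiε⟩ := Finset.not_subset.mp hsub
      have hij : i ≠ j := fun h => hiε (h ▸ hj)
      have h0 : ∀ x y : R, ∏ i ∈ δ,
          ![x, y, 0] (if i = j then 0 else if i ∈ ε then 1 else 2) = 0 := fun x y =>
        Finset.prod_eq_zero hi (by simp [hij, hiε])
      simp [h0]

/-- A map preserving a non-linear sum of monomials preserves the product, the join or the
median. -/
lemma preserves_mul_or_join_or_median {ι : Type*} {S : Finset (Finset ι)}
    (hS : ∃ ε ∈ S, 2 ≤ ε.card) {φ : R → R}
    (h : ∀ x : ι → R, φ (monomialSum S x) = monomialSum S fun i => φ (x i)) :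
    (∀ x y, φ (x * y) = φ x * φ y) ∨
      (∀ x y, φ (x * y + x + y) = φ x * φ y + φ x + φ y) ∨
      ∀ x y z, φ (x * y + y * z + z * x) = φ x * φ y + φ y * φ z + φ z * φ x := by
  obtain ⟨τ, hτ⟩ := exists_merge_second_difference_eq_one (R := R) hS
  obtain ⟨p, s, q, r, a, b, c, d, hp, -, hq, hr, ha, hb, hc, hd, hpoly⟩ :=
    exists_coeff_monomialSum_comp (R := R) S τ
  obtain rfl : s = 1 := by
    have htwo : (2 : R) = 0 := BooleanRing.two_eq_zero
    simp only [hpoly] at hτ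
    clear hpoly h
    grind
  refine preserves_mul_or_join_or_median_of_ternary hp hq hr ha hb hc hd fun x y z => ?_
  have h1 := h fun i => ![x, y, z] (τ i)
  have h2 : (fun i => φ (![x, y, z] (τ i))) = fun i => ![φ x, φ y, φ z] (τ i) := by
    funext i
    generalize τ i = t
    fin_cases t <;> rfl
  rw [h2, hpoly, hpoly] at h1
  simpa only [one_mul] using h1

/-- Sums of monomials are local: modulo the annihilator of `e`, the value only depends on the
arguments modulo the annihilator of `e`. -/
lemma monomialSum_mul_congr {ι : Type*} (S : Finset (Finset ι)) {x y : ι → R} {e : R}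
    (h : ∀ i, x i * e = y i * e) : monomialSum S x * e = monomialSum S y * e := by
  classical
  simp only [monomialSum, Finset.sum_mul]
  refine Finset.sum_congr rfl fun ε hε => ?_
  clear hε
  induction ε using Finset.induction_on with
  | empty => simp
  | insert i ε hi ih =>
    rw [Finset.prod_insert hi, Finset.prod_insert hi, mul_assoc, ih, mul_left_comm, h,
      mul_left_comm, mul_assoc]

/-- A sum of monomials maps `{0, 1}`-valued points into `{0, 1}`. -/
lemma monomialSum_zero_or_one {ι : Type*} (S : Finset (Finset ι)) {x : ι → R}
    (h : ∀ i, x i = 0 ∨ x i = 1) : monomialSum S x = 0 ∨ monomialSum S x = 1 := by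
  classical
  refine Finset.sum_induction _ (fun a : R => a = 0 ∨ a = 1) (fun _ _ => zero_or_one_add)
    (.inl rfl) fun ε _ => ?_
  refine Finset.prod_induction _ (fun a : R => a = 0 ∨ a = 1) ?_ (.inr rfl) fun i _ => h i
  rintro a b (rfl | rfl) hb <;> simp [hb]

/-- A local function vanishing at all `{0, 1}`-valued points vanishes. -/
lemma eq_zero_of_local_of_zero_or_one {ι : Type*} [Finite ι] {h : (ι → R) → R}
    (hloc : ∀ x y e, (∀ i, x i * e = y i * e) → h x * e = h y * e)
    (h01 : ∀ x : ι → R, (∀ i, x i = 0 ∨ x i = 1) → h x = 0) (x : ι → R) : h x = 0 := by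
  classical
  cases nonempty_fintype ι
  suffices ∀ (s : Finset ι) (x : ι → R), (∀ i ∉ s, x i = 0 ∨ x i = 1) → h x = 0 from
    this Finset.univ x (by simp)
  intro s
  induction s using Finset.induction_on with
  | empty => exact fun x hx => h01 x fun i => hx i (by simp)
  | insert j s hj ih =>
    intro x hx
    have hm : x j * x j = x j := BooleanRing.mul_self _
    have hupd : ∀ v : R, (v = 0 ∨ v = 1) → h (Function.update x j v) = 0 := by
      refine fun v hv => ih _ fun i hi => ?_
      by_cases hij : i = j
      · subst hij; simpa using hv
      · simpa [hij] using hx i (by simp [hij, hi])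
    have h1 := hloc x (Function.update x j 1) (x j) fun i => by
      by_cases hij : i = j
      · subst hij; simp [hm]
      · simp [hij]
    have h0 := hloc x (Function.update x j 0) (1 + x j) fun i => by
      by_cases hij : i = j
      · subst hij; simp [mul_add, hm, BooleanRing.add_self]
      · simp [hij]
    rw [hupd 1 (.inr rfl), zero_mul] at h1
    rw [hupd 0 (.inl rfl), zero_mul, mul_add, h1, mul_one, add_zero] at h0
    exact h0

/-- If one nontrivial translation preserves a sum of monomials, then all translations do. -/
lemma monomialSum_add_of_exists {ι : Type*} [Finite ι] {S : Finset (Finset ι)} {c : R}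
    (hc : c ≠ 0) (h : ∀ x : ι → R, monomialSum S (fun i => x i + c) = monomialSum S x + c)
    (e : R) (x : ι → R) : monomialSum S (fun i => x i + e) = monomialSum S x + e := by
  have hm : ∀ x : R, x * x = x := BooleanRing.mul_self
  have htwo : (2 : R) = 0 := BooleanRing.two_eq_zero
  have hone : ∀ x : ι → R, monomialSum S (fun i => x i + 1) + monomialSum S x + 1 = 0 := by
    refine eq_zero_of_local_of_zero_or_one (fun x y e hxy => ?_) fun x hx => ?_
    · have h1 := monomialSum_mul_congr S hxy
      have h2 := monomialSum_mul_congr S (x := fun i => x i + 1) (y := fun i => y i + 1) (e := e)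
        fun i => by rw [add_mul, hxy, add_mul]
      rw [add_mul, add_mul, h1, h2, ← add_mul, ← add_mul]
    · have h1 := monomialSum_mul_congr S (x := fun i => x i + c) (y := fun i => x i + 1) (e := c)
        fun i => by rw [add_mul, add_mul, hm, one_mul]
      rw [h] at h1
      rcases zero_or_one_add (zero_or_one_add
        (monomialSum_zero_or_one S fun i => zero_or_one_add (hx i) (.inr rfl))
        (monomialSum_zero_or_one S hx)) (.inr rfl) with h2 | h2
      · exact h2
      · refine absurd ?_ hc
        have hcc := hm c
        clear h hm
        grind
  have h1 := monomialSum_mul_congr S (x := fun i => x i + e) (y := fun i => x i + 1) (e := e)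
    fun i => by rw [add_mul, add_mul, hm, one_mul]
  have h2 := monomialSum_mul_congr S (x := fun i => x i + e) (y := x) (e := 1 + e)
    fun i => by
      clear h hone h1
      have hee := hm e
      clear hm
      grind
  have h3 := hone x
  clear h hone hm
  grind

end BooleanRing

section BooleanAlgebra

variable {B : Type*} [BooleanAlgebra B]

lemma toBoolRing_termFun {k : ℕ} (S : Finset (Finset (Fin k))) (x : Fin k → B) :
    toBoolRing (termFun S x) = monomialSum S fun i => toBoolRing (x i) := by
  classical
  have hinf : ∀ ε : Finset (Fin k), toBoolRing (ε.inf x) = ∏ i ∈ ε, toBoolRing (x i) := by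
    intro ε
    induction ε using Finset.induction_on with
    | empty => rfl
    | insert i ε hi ih => rw [Finset.inf_insert, toBoolRing_inf, ih, Finset.prod_insert hi]
  unfold termFun monomialSum
  induction S using Finset.induction_on with
  | empty => rfl
  | insert ε S hε ih =>
    rw [Finset.fold_insert hε, Finset.sum_insert hε, toBoolRing_symmDiff, ih, hinf]

/-- A bijection preserving meets is a Boolean automorphism. -/
lemma isBoolAut_of_inf {φ : B → B} (hφ : Function.Bijective φ)
    (h : ∀ x y, φ (x ⊓ y) = φ x ⊓ φ y) : IsBoolAut φ := by
  let e : B ≃o B := ⟨Equiv.ofBijective φ hφ, fun {x y} => by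
    simp only [Equiv.ofBijective_apply, ← inf_eq_left, ← h, hφ.1.eq_iff]⟩
  exact ⟨hφ, h, e.map_sup, fun x => map_compl' e x⟩

/-- A bijection preserving joins is a Boolean automorphism. -/
lemma isBoolAut_of_sup {φ : B → B} (hφ : Function.Bijective φ)
    (h : ∀ x y, φ (x ⊔ y) = φ x ⊔ φ y) : IsBoolAut φ := by
  let e : B ≃o B := ⟨Equiv.ofBijective φ hφ, fun {x y} => by
    simp only [Equiv.ofBijective_apply, ← sup_eq_right, ← h, hφ.1.eq_iff]⟩
  exact ⟨hφ, e.map_inf, h, fun x => map_compl' e x⟩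

lemma IsBoolAut.map_symmDiff {φ : B → B} (hφ : IsBoolAut φ) (x y : B) :
    φ (x ∆ y) = φ x ∆ φ y := by
  obtain ⟨-, hi, hs, hc⟩ := hφ
  simp only [symmDiff, sdiff_eq, hi, hs, hc]

lemma IsBoolAut.map_bot {φ : B → B} (hφ : IsBoolAut φ) : φ ⊥ = ⊥ := by
  simpa using hφ.map_symmDiff ⊥ ⊥

lemma IsBoolAut.map_top {φ : B → B} (hφ : IsBoolAut φ) : φ ⊤ = ⊤ := by
  rw [← compl_bot, hφ.2.2.2, hφ.map_bot]

lemma IsBoolAut.map_median {φ : B → B} (hφ : IsBoolAut φ) (x y z : B) :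
    φ (median x y z) = median (φ x) (φ y) (φ z) := by
  simp only [median, hφ.map_symmDiff, hφ.2.1]

lemma IsBoolAut.map_termFun {φ : B → B} (hφ : IsBoolAut φ) {k : ℕ}
    (S : Finset (Finset (Fin k))) : Preserves φ (termFun S) := by
  classical
  intro x
  have hinf : ∀ ε : Finset (Fin k), φ (ε.inf x) = ε.inf fun i => φ (x i) := by
    intro ε
    induction ε using Finset.induction_on with
    | empty => exact hφ.map_top
    | insert i ε hi ih => rw [Finset.inf_insert, hφ.2.1, ih, Finset.inf_insert]
  unfold termFun
  induction S using Finset.induction_on with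
  | empty => exact hφ.map_bot
  | insert ε S hε ih =>
    rw [Finset.fold_insert hε, Finset.fold_insert hε, hφ.map_symmDiff, ih, hinf]

/-- A bijection preserving the median is a translate of a Boolean automorphism. -/
lemma isBoolAut_symmDiff_of_median {φ : B → B} (hφ : Function.Bijective φ)
    (h : ∀ x y z, φ (median x y z) = median (φ x) (φ y) (φ z)) :
    IsBoolAut fun x => φ x ∆ φ ⊥ := by
  refine isBoolAut_of_inf ((symmDiff_left_involutive (φ ⊥)).bijective.comp hφ) fun x y => ?_
  have h1 := h x y ⊥
  rw [show median x y ⊥ = x ⊓ y by simp [median]] at h1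
  rw [h1]
  generalize φ x = u, φ y = v, φ ⊥ = c
  apply toBoolRing.injective
  simp only [median, toBoolRing_symmDiff, toBoolRing_inf]
  have hm := BooleanRing.mul_self (toBoolRing c)
  have htwo : (2 : AsBoolRing B) = 0 := BooleanRing.two_eq_zero
  clear h1
  grind

/-- Every bijection preserving a non-linear term function preserves the median. -/
lemma map_median_of_preserves_termFun {k : ℕ} {S : Finset (Finset (Fin k))}
    (hS : ∃ ε ∈ S, 2 ≤ ε.card) {φ : B → B} (hφ : Function.Bijective φ)
    (h : Preserves φ (termFun S)) (x y z : B) :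
    φ (median x y z) = median (φ x) (φ y) (φ z) := by
  have hsup : ∀ x y : B, x ⊔ y = (x ⊓ y) ∆ x ∆ y := fun x y => by
    rw [symmDiff_assoc, inf_symmDiff_symmDiff]
  have key := preserves_mul_or_join_or_median (R := AsBoolRing B) hS
    (φ := fun x => toBoolRing (φ (ofBoolRing x))) fun x => by
      have h1 := congrArg toBoolRing (h fun i => ofBoolRing (x i))
      rw [toBoolRing_termFun] at h1
      rw [← h1]
      congr 2
  rcases key with hmul | hjoin | hmed
  · exact (isBoolAut_of_inf hφ hmul).map_median x y z
  · refine (isBoolAut_of_sup hφ fun x y => ?_).map_median x y z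
    rw [hsup, hsup]
    exact hjoin x y
  · simp only [median, ← symmDiff_assoc]
    exact hmed x y z

/-- If one nontrivial translation preserves a term function, then all translations do. -/
lemma termFun_symmDiff_of_exists {k : ℕ} {S : Finset (Finset (Fin k))} {c : B}
    (hc : c ≠ ⊥) (h : ∀ x, termFun S (fun i => x i ∆ c) = termFun S x ∆ c)
    (e : B) (x : Fin k → B) : termFun S (fun i => x i ∆ e) = termFun S x ∆ e := by
  apply toBoolRing.injective
  rw [toBoolRing_symmDiff, toBoolRing_termFun, toBoolRing_termFun]
  refine monomialSum_add_of_exists (R := AsBoolRing B) (c := toBoolRing c) hc (fun x => ?_) _ _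
  have h1 := congrArg toBoolRing (h fun i => ofBoolRing (x i))
  rwa [toBoolRing_symmDiff, toBoolRing_termFun, toBoolRing_termFun] at h1

lemma compl_median (x y z : B) : (median x y z)ᶜ = median xᶜ yᶜ zᶜ := by
  simp only [← hnot_eq_compl, ← top_symmDiff]
  apply toBoolRing.injective
  simp only [median, toBoolRing_symmDiff, toBoolRing_inf, toBoolRing_top]
  have htwo : (2 : AsBoolRing B) = 0 := BooleanRing.two_eq_zero
  grind

end BooleanAlgebra

/-- For every non-linear term function `f` of the countable atomless Boolean algebra `B`,
exactly one of the following holds: the group of bijections preserving `f` is the group of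
Boolean automorphisms of `B`, or it is the group of all bijections preserving the median. -/
theorem aut_nonlinear_eq_autB_xor_autMedian
    (B : Type*) [BooleanAlgebra B] [Countable B] [Nontrivial B] (hAtomless : Atomless B)
    {k : ℕ} (f : (Fin k → B) → B) (hf : IsNonLinearTermFun f) :
    Xor'
      ({φ : B → B | Function.Bijective φ ∧ Preserves φ f} = {φ : B → B | IsBoolAut φ})
      ({φ : B → B | Function.Bijective φ ∧ Preserves φ f} =
        {φ : B → B | Function.Bijective φ ∧
          ∀ x y z, φ (median x y z) = median (φ x) (φ y) (φ z)}) := by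
  obtain ⟨S, hfS, hS⟩ := hf
  obtain rfl : f = termFun S := funext hfS
  have hne : {φ : B → B | IsBoolAut φ} ≠ {φ : B → B | Function.Bijective φ ∧
      ∀ x y z, φ (median x y z) = median (φ x) (φ y) (φ z)} := fun heq => by
    have hcompl : (compl : B → B) ∈ {φ : B → B | IsBoolAut φ} := by
      rw [heq]
      exact ⟨compl_involutive.bijective, compl_median⟩
    have hbot := IsBoolAut.map_bot hcompl
    rw [compl_bot] at hbot
    exact bot_ne_top hbot.symm
  by_cases hT : ∀ (c : B) (x : Fin k → B), termFun S (fun i => x i ∆ c) = termFun S x ∆ c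
  · have hQ : {φ : B → B | Function.Bijective φ ∧ Preserves φ (termFun S)} =
        {φ : B → B | Function.Bijective φ ∧
          ∀ x y z, φ (median x y z) = median (φ x) (φ y) (φ z)} := by
      ext φ
      refine ⟨fun ⟨hφ, h⟩ => ⟨hφ, map_median_of_preserves_termFun hS hφ h⟩,
        fun ⟨hφ, h⟩ => ⟨hφ, fun x => ?_⟩⟩
      have h1 := (isBoolAut_symmDiff_of_median hφ h).map_termFun S x
      rw [hT] at h1
      exact symmDiff_left_injective _ h1
    exact .inr ⟨hQ, fun hP => hne (hP.symm.trans hQ)⟩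
  · have hP : {φ : B → B | Function.Bijective φ ∧ Preserves φ (termFun S)} =
        {φ : B → B | IsBoolAut φ} := by
      ext φ
      refine ⟨fun ⟨hφ, h⟩ => ?_, fun h => ⟨h.1, h.map_termFun S⟩⟩
      have hψ := isBoolAut_symmDiff_of_median hφ (map_median_of_preserves_termFun hS hφ h)
      by_cases hc : φ ⊥ = ⊥
      · simp only [hc, symmDiff_bot] at hψ
        exact hψ
      · refine absurd (termFun_symmDiff_of_exists hc fun y => ?_) hT
        obtain ⟨x, rfl⟩ : ∃ x : Fin k → B, (fun i => φ (x i)) = y :=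
          ⟨_, funext fun i => (hφ.2 (y i)).choose_spec⟩
        rw [← hψ.map_termFun S x, ← h x]
    exact .inl ⟨hP, fun hQ => hne (hP.symm.trans hQ)⟩
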